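/- Let D be a database and Σ ∈ SL a finite set of simple linear TGDs. If there exists an integer k ≥ 0 such that maxdepth(D,Σ) ≤ k, then Σ is D-weakly-acyclic. -/

import Mathlib

set_option maxHeartbeats 1000000

/-! ### Basic syntax: atoms, TGDs, terms -/

/-- An atom: a predicate name together with a list of arguments. -/
structure Atom (T : Type) where
  pred : ℕ
  args : List T
deriving DecidableEq

def Atom.map {T U : Type} (f : T → U) (a : Atom T) : Atom U :=
  ⟨a.pred, a.args.map f⟩

/-- The signature (predicate name, arity) of an atom. -/
def Atom.sig {T : Type} (a : Atom T) : ℕ × ℕ := (a.pred, a.args.length)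

def Atom.equivProd : Atom ℕ ≃ ℕ × List ℕ where
  toFun a := (a.pred, a.args)
  invFun p := ⟨p.1, p.2⟩
  left_inv a := rfl
  right_inv p := rfl

instance : Encodable (Atom ℕ) := Encodable.ofEquiv _ Atom.equivProd

/-- A tuple-generating dependency, given by its (non-empty) body and head,
whose atoms carry variables (natural numbers) as arguments. -/
structure TGD where
  body : List (Atom ℕ)
  head : List (Atom ℕ)
  body_ne : body ≠ []
  head_ne : head ≠ []

def atomVars (a : Atom ℕ) : Finset ℕ := a.args.toFinset

def TGD.bodyVars (σ : TGD) : Finset ℕ := σ.body.foldr (fun a s => atomVars a ∪ s) ∅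
def TGD.headVars (σ : TGD) : Finset ℕ := σ.head.foldr (fun a s => atomVars a ∪ s) ∅
/-- The frontier of a TGD: variables occurring both in the body and in the head. -/
def TGD.frontier (σ : TGD) : Finset ℕ := σ.bodyVars ∩ σ.headVars
/-- The existentially quantified variables: head variables not occurring in the body. -/
def TGD.exVars (σ : TGD) : Finset ℕ := σ.headVars \ σ.bodyVars

/-- Terms: constants, and labelled nulls `⊥^z_{σ,h}` determined by a TGD `σ`,
a substitution `h` (the restriction of the trigger homomorphism to the frontier)
and a variable `z`. -/
inductive TermT : Type where
  | const : ℕ → TermT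
  | null : TGD → (ℕ → TermT) → ℕ → TermT

/-- The depth of a term. -/
def TermT.depth : TermT → ℕ
  | .const _ => 0
  | .null σ h _ => 1 + σ.frontier.sup (fun x => (h x).depth)

/-- The depth of an atom: the maximal depth of its arguments. -/
def Atom.depth (a : Atom TermT) : ℕ := (a.args.map TermT.depth).foldr max 0

/-! ### The semi-oblivious chase -/

/-- Restriction of a substitution to the frontier of a TGD (with default value elsewhere). -/
def TGD.restrict (σ : TGD) (h : ℕ → TermT) : ℕ → TermT :=
  fun x => if x ∈ σ.frontier then h x else .const 0

/-- The map `μ` sending each frontier variable `x` to `h x` and each other (existential)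
variable `z` to the null `⊥^z_{σ,h|fr(σ)}`. -/
def TGD.mu (σ : TGD) (h : ℕ → TermT) : ℕ → TermT :=
  fun x => if x ∈ σ.frontier then h x else .null σ (σ.restrict h) x

/-- The result of the trigger `(σ,h)`. -/
def TGD.result (σ : TGD) (h : ℕ → TermT) : Set (Atom TermT) :=
  {a | ∃ b ∈ σ.head, a = b.map (σ.mu h)}

abbrev Database := Finset (Atom ℕ)
abbrev Instance := Set (Atom TermT)

def dbInstance (D : Database) : Instance := (Atom.map TermT.const) '' ↑D

/-- `chase D S` (the result of any valid semi-oblivious chase derivation of `D` w.r.t. `S`),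
defined as the least set of atoms containing `D` and closed under all triggers. -/
inductive InChase (D : Database) (S : Set TGD) : Atom TermT → Prop
  | db {a : Atom ℕ} : a ∈ D → InChase D S (a.map TermT.const)
  | step {σ : TGD} (hσ : σ ∈ S) (h : ℕ → TermT)
      (hb : ∀ b ∈ σ.body, InChase D S (b.map h))
      {a : Atom TermT} (ha : a ∈ σ.result h) : InChase D S a

def chase (D : Database) (S : Set TGD) : Instance := {a | InChase D S a}

/-- The active domain of an instance: the set of terms occurring in it. -/
def adom (I : Instance) : Set TermT := {t | ∃ a ∈ I, t ∈ a.args}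

/-- `Σ ∈ CT_D`: the chase of `D` w.r.t. `Σ` is finite. -/
def InCT (D : Database) (S : Set TGD) : Prop := (chase D S).Finite

open Classical in
/-- The maximal depth of a term occurring in `chase D S`, and `⊤` if the chase is infinite. -/
noncomputable def maxdepth (D : Database) (S : Set TGD) : ℕ∞ :=
  if (chase D S).Finite then ⨆ t ∈ adom (chase D S), (TermT.depth t : ℕ∞) else ⊤

/-! ### Schema, arity, classes of TGDs -/

def TGD.atomsList (σ : TGD) : List (Atom ℕ) := σ.body ++ σ.head

/-- The schema of a set of TGDs: the (predicate name, arity) pairs occurring in it. -/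
def sch (S : Set TGD) : Set (ℕ × ℕ) := {p | ∃ σ ∈ S, ∃ a ∈ σ.atomsList, a.sig = p}

/-- The maximal arity of a predicate of the schema. -/
noncomputable def arity (S : Set TGD) : ℕ := sSup ((fun p => p.2) '' sch S)

/-- The set of atoms occurring in the TGDs of `S`. -/
def atomsOf (S : Set TGD) : Set (Atom ℕ) := {a | ∃ σ ∈ S, a ∈ σ.atomsList}

/-- `‖Σ‖ = |atoms(Σ)| · |sch(Σ)| · ar(Σ)`. -/
noncomputable def tgdNorm (S : Set TGD) : ℕ := (atomsOf S).ncard * (sch S).ncard * arity S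

/-- A TGD is guarded if some body atom contains all body variables. -/
def TGD.Guarded (σ : TGD) : Prop := ∃ a ∈ σ.body, σ.bodyVars ⊆ atomVars a

/-- A TGD is linear if its body consists of a single atom. -/
def TGD.Linear (σ : TGD) : Prop := ∃ a, σ.body = [a]

/-- A TGD is simple linear if its body is a single atom without repeated variables. -/
def TGD.SimpleLinear (σ : TGD) : Prop := ∃ a, σ.body = [a] ∧ a.args.Nodup

/-- The guard of a TGD: the leftmost body atom containing all body variables. -/
def TGD.guard (σ : TGD) : Atom ℕ :=
  (σ.body.find? (fun a => decide (σ.bodyVars ⊆ atomVars a))).getD ⟨0, []⟩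

/-! ### Chase derivations and the guarded chase forest -/

def IsTrigger (S : Set TGD) (σ : TGD) (h : ℕ → TermT) (I : Instance) : Prop :=
  σ ∈ S ∧ ∀ b ∈ σ.body, b.map h ∈ I

def IsActive (S : Set TGD) (σ : TGD) (h : ℕ → TermT) (I : Instance) : Prop :=
  IsTrigger S σ h I ∧ ¬ σ.result h ⊆ I

/-- A chase derivation of `D` w.r.t. `S`: at each step either an active trigger is applied,
or no active trigger exists and the instance stays put (the derivation has terminated). -/
structure ChaseDerivation (D : Database) (S : Set TGD) where
  inst : ℕ → Instance
  trig : ℕ → Option (TGD × (ℕ → TermT))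
  init : inst 0 = dbInstance D
  step_some : ∀ i σ h, trig i = some (σ, h) →
    IsActive S σ h (inst i) ∧ inst (i + 1) = inst i ∪ σ.result h
  step_none : ∀ i, trig i = none →
    (∀ σ h, ¬ IsActive S σ h (inst i)) ∧ inst (i + 1) = inst i

/-- The derivation is finite: it eventually reaches an instance with no active trigger. -/
def ChaseDerivation.IsFiniteDer {D : Database} {S : Set TGD} (δ : ChaseDerivation D S) : Prop :=
  ∃ i, δ.trig i = none

/-- Fairness: every active trigger eventually becomes non-active. -/
def ChaseDerivation.Fair {D : Database} {S : Set TGD} (δ : ChaseDerivation D S) : Prop :=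
  ∀ i σ h, IsActive S σ h (δ.inst i) → ∃ j, i < j ∧ ¬ IsActive S σ h (δ.inst j)

def ChaseDerivation.Valid {D : Database} {S : Set TGD} (δ : ChaseDerivation D S) : Prop :=
  δ.IsFiniteDer ∨ δ.Fair

/-- The edge relation of the guarded chase forest of a derivation. -/
def gedge {D : Database} {S : Set TGD} (δ : ChaseDerivation D S) (α β : Atom TermT) : Prop :=
  ∃ i σ h, δ.trig i = some (σ, h) ∧ α = (TGD.guard σ).map h ∧
    β ∈ δ.inst (i + 1) \ δ.inst i

/-- The tree of the guarded chase forest rooted at the database atom `α`. -/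
def gtree {D : Database} {S : Set TGD} (δ : ChaseDerivation D S) (α : Atom ℕ) : Set (Atom TermT) :=
  {β | Relation.ReflTransGen (gedge δ) (α.map TermT.const) β}

/-- The atoms of depth `i` in the tree rooted at `α`. -/
def gtreeLevel {D : Database} {S : Set TGD} (δ : ChaseDerivation D S) (α : Atom ℕ) (i : ℕ) :
    Set (Atom TermT) :=
  {β ∈ gtree δ α | Atom.depth β = i}

/-! ### Dependency graph, reachability and non-uniform weak-acyclicity -/

/-- A position `(R, i)` of a schema: a (predicate name, arity) pair and an argument index. -/
abbrev Pos := (ℕ × ℕ) × ℕ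

def occursAt {T : Type} (x : T) (a : Atom T) (p : Pos) : Prop :=
  p.1 = a.sig ∧ a.args[p.2]? = some x

/-- Normal edges of the dependency graph. -/
def NormalEdge (S : Set TGD) (p q : Pos) : Prop :=
  ∃ σ ∈ S, ∃ x ∈ σ.frontier, (∃ a ∈ σ.body, occursAt x a p) ∧ (∃ b ∈ σ.head, occursAt x b q)

/-- Special edges of the dependency graph. -/
def SpecialEdge (S : Set TGD) (p q : Pos) : Prop :=
  ∃ σ ∈ S, ∃ x ∈ σ.frontier, (∃ a ∈ σ.body, occursAt x a p) ∧
    (∃ z ∈ σ.exVars, ∃ b ∈ σ.head, occursAt z b q)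

def predEdge (S : Set TGD) (R P : ℕ × ℕ) : Prop :=
  ∃ σ ∈ S, (∃ a ∈ σ.body, a.sig = R) ∧ (∃ b ∈ σ.head, b.sig = P)

/-- `R ⤳_Σ P`: predicate reachability. -/
def Reach (S : Set TGD) : (ℕ × ℕ) → (ℕ × ℕ) → Prop := Relation.ReflTransGen (predEdge S)

/-- `Σ` is `D`-weakly-acyclic: no `D`-supported cycle of the dependency graph
contains a special edge. -/
def DWeaklyAcyclic (D : Database) (S : Set TGD) : Prop :=
  ¬ ∃ (n : ℕ) (c : ℕ → Pos) (sp : ℕ → Bool),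
      c (n + 1) = c 0 ∧
      (∀ i ≤ n, if sp i then SpecialEdge S (c i) (c (i + 1))
                else NormalEdge S (c i) (c (i + 1))) ∧
      (∃ i ≤ n, sp i = true) ∧
      (∃ i ≤ n, ∃ a ∈ D, Reach S a.sig (c i).1)

noncomputable def dSL (S : Set TGD) : ℕ := (sch S).ncard * arity S
noncomputable def fSL (S : Set TGD) : ℕ := (dSL S + 1) * tgdNorm S ^ (2 * arity S * (dSL S + 1))
noncomputable def dL (S : Set TGD) : ℕ := (sch S).ncard * arity S ^ (arity S + 1)
noncomputable def fL (S : Set TGD) : ℕ := (dL S + 1) * tgdNorm S ^ (2 * arity S * (dL S + 1))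
noncomputable def dG (S : Set TGD) : ℕ :=
  (sch S).ncard * arity S ^ (2 * arity S + 1) * 2 ^ ((sch S).ncard * arity S ^ arity S)
noncomputable def fG (S : Set TGD) : ℕ := (dG S + 1) * tgdNorm S ^ (2 * arity S * (dG S + 1))

/-! ### Simplification -/

open Classical in
/-- `unique(t̄)`: keep only the first occurrence of each term. -/
noncomputable def uniqueList {α : Type} : List α → List α
  | [] => []
  | a :: l => a :: uniqueList (l.filter fun b => decide (b ≠ a))
termination_by l => l.length
decreasing_by
  simp only [List.length_cons, List.length_unattach]
  exact Nat.lt_succ_of_le ((List.length_filter_le _ _).trans_eq List.length_attach)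

open Classical in
/-- `id(t̄)`: for each component, the position of `unique(t̄)` at which it appears. -/
noncomputable def idTuple {α : Type} (l : List α) : List ℕ :=
  l.map (fun t => (uniqueList l).idxOf t)

/-- The simplification of an atom `R(t̄)`: the atom `R_{id(t̄)}(unique(t̄))`, where the
fresh predicate name `R_{id(t̄)}` is obtained by pairing `R` with an encoding of `id(t̄)`. -/
noncomputable def simpleAtom {α : Type} (a : Atom α) : Atom α :=
  ⟨Nat.pair a.pred (Encodable.encode (idTuple a.args)), uniqueList a.args⟩

/-- `simple(D)`. -/
noncomputable def simpleDB (D : Database) : Database := D.image simpleAtom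

/-- A specialization of the tuple of variables `xs`:
`f x₁ = x₁`, `f xᵢ ∈ {f x₁, …, f xᵢ₋₁, xᵢ}`, and `f` is the identity off `xs`. -/
def IsSpecialization (xs : List ℕ) (f : ℕ → ℕ) : Prop :=
  (∀ v, v ∉ xs → f v = v) ∧
  ∀ i : Fin xs.length, f (xs.get i) ∈ ((xs.take i).map f) ++ [xs.get i]

/-- The body atom of a (linear) TGD. -/
def TGD.bodyAtom (σ : TGD) : Atom ℕ := σ.body.head σ.body_ne

/-- The simplification of a linear TGD induced by a specialization `f`. -/
noncomputable def TGD.simplify (σ : TGD) (f : ℕ → ℕ) : TGD where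
  body := [simpleAtom (σ.bodyAtom.map f)]
  head := σ.head.map (fun b => simpleAtom (b.map f))
  body_ne := by simp
  head_ne := by
    intro hcon
    exact σ.head_ne (List.map_eq_nil_iff.mp hcon)

/-- `simple(Σ)`: all simplifications of TGDs of `Σ` induced by some specialization. -/
def simpleTGDs (S : Set TGD) : Set TGD :=
  {τ | ∃ σ ∈ S, ∃ f : ℕ → ℕ, IsSpecialization σ.bodyAtom.args f ∧ τ = σ.simplify f}

/-- Equivalence of terms up to simplification: the map
`g = {f x ↦ h x : x ∈ fr(σ)}` is a well-defined function on `fr(σ_f)` (witnessed by the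
section `sec` of `f`), and `g y ≡_sim h' y` for every `y ∈ fr(σ_f)`. -/
inductive EqSim : TermT → TermT → Prop
  | const (c : ℕ) : EqSim (.const c) (.const c)
  | null (σ : TGD) (f : ℕ → ℕ) (sec : ℕ → ℕ) (h h' : ℕ → TermT) (z : ℕ)
      (hf : IsSpecialization σ.bodyAtom.args f)
      (hfun : ∀ x ∈ σ.frontier, ∀ y ∈ σ.frontier, f x = f y → h x = h y)
      (hdom : ∀ x ∈ σ.frontier, f x ∈ (σ.simplify f).frontier)
      (hsec : ∀ y ∈ (σ.simplify f).frontier, sec y ∈ σ.frontier ∧ f (sec y) = y)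
      (hrec : ∀ y ∈ (σ.simplify f).frontier, EqSim (h (sec y)) (h' y)) :
      EqSim (.null σ h z) (.null (σ.simplify f) h' z)

/-- `t̄ ≃ ū`: same length and the same equalities among components. -/
def tupleEquiv {A B : Type} (t : List A) (u : List B) : Prop :=
  t.length = u.length ∧ ∀ i j, i < t.length → j < t.length → (t[i]? = t[j]? ↔ u[i]? = u[j]?)

/-- Equivalence of atoms up to simplification. -/
noncomputable def AtomEqSim (α β : Atom TermT) : Prop :=
  β.pred = Nat.pair α.pred (Encodable.encode (idTuple α.args)) ∧
  tupleEquiv (uniqueList α.args) β.args ∧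
  List.Forall₂ EqSim (uniqueList α.args) β.args

/-! ### Linearization -/

/-- The symbolic representation of a type: a canonical guard atom over positive integers
together with a finite set of further atoms over its terms. -/
abbrev SigmaType := Atom ℕ × Finset (Atom ℕ)

/-- A canonical tuple of positive integers: `t₁ = 1` and `tᵢ ≤ max(t₁,…,tᵢ₋₁) + 1`. -/
def IsCanonicalTuple (l : List ℕ) : Prop :=
  ∀ (i : ℕ) (h : i < l.length), 1 ≤ l[i] ∧ l[i] ≤ ((l.take i).foldr max 0) + 1

def atomsOfType (τ : SigmaType) : Finset (Atom ℕ) := insert τ.1 τ.2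

def IsSigmaType (S : Set TGD) (τ : SigmaType) : Prop :=
  IsCanonicalTuple τ.1.args ∧ τ.1.sig ∈ sch S ∧
  (∀ b ∈ τ.2, b.sig ∈ sch S ∧ ∀ t ∈ b.args, t ∈ τ.1.args) ∧ τ.1 ∉ τ.2

open Classical in
noncomputable def setToFinset {α : Type} (s : Set α) : Finset α :=
  if h : s.Finite then h.toFinset else ∅

open Classical in
/-- Canonical renaming: the `i`-th distinct value of `base` (by first occurrence)
is sent to the integer `i` (1-based). -/
noncomputable def canonInt {α : Type} (base : List α) (c : α) : ℕ :=
  (uniqueList base).idxOf c + 1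

/-- The type (over the constants of `a`) of the database atom `a` w.r.t. `D` and `S`. -/
def typeOfDBAtom (D : Database) (S : Set TGD) (a : Atom ℕ) : Set (Atom ℕ) :=
  {b | (b.map TermT.const) ∈ chase D S ∧ ∀ c ∈ b.args, c ∈ a.args}

/-- The linearization of a database atom: `[τ](t̄)` where `τ` encodes the atom and its type. -/
noncomputable def linAtom (D : Database) (S : Set TGD) (a : Atom ℕ) : Atom ℕ :=
  let ρ : ℕ → ℕ := canonInt a.args
  let g : Atom ℕ := a.map ρ
  let τ : SigmaType := (g, (setToFinset ((Atom.map ρ) '' typeOfDBAtom D S a)).erase g)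
  ⟨Encodable.encode τ, a.args⟩

/-- `lin(D)`. -/
noncomputable def linDB (D : Database) (S : Set TGD) : Database := D.image (linAtom D S)

/-- `complete(I,Σ)`: the atoms of the chase of `I` whose terms all belong to `adom(I)`. -/
def completeDB (I : Database) (S : Set TGD) : Set (Atom ℕ) :=
  {a | (a.map TermT.const) ∈ chase I S ∧ ∀ c ∈ a.args, ∃ b ∈ I, c ∈ b.args}

/-- The index (1-based) of an existential variable of a TGD. -/
noncomputable def TGD.exIndex (σ : TGD) (v : ℕ) : ℕ := (σ.exVars.sort (· ≤ ·)).idxOf v + 1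

/-- The function `f` of the linearization: frontier variables are mapped by `h`, the `i`-th
existential variable to `ar(Σ) + i`. -/
noncomputable def headMap (S : Set TGD) (σ : TGD) (h : ℕ → ℕ) : ℕ → ℕ :=
  fun v => if v ∈ σ.frontier then h v else arity S + σ.exIndex v

/-- The Σ-type associated with the head atom `b` of `σ` in the linearization step. -/
noncomputable def headTypeOf (S : Set TGD) (σ : TGD) (τ : SigmaType) (h : ℕ → ℕ)
    (b : Atom ℕ) : SigmaType :=
  let f := headMap S σ h
  let αi : Atom ℕ := b.map f
  let I : Database := (σ.head.map (Atom.map f)).toFinset ∪ atomsOfType τ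
  let Ti : Set (Atom ℕ) := {β | β ∈ completeDB I S ∧ ∀ t ∈ β.args, t ∈ αi.args} \ {αi}
  let ρ : ℕ → ℕ := canonInt αi.args
  (αi.map ρ, setToFinset ((Atom.map ρ) '' Ti))

/-- The linearization of the guarded TGD `σ` induced by the Σ-type `τ` and the
homomorphism `h` from `body(σ)` to `atoms(τ)` mapping the guard to `guard(τ)`. -/
noncomputable def linTGD (S : Set TGD) (σ : TGD) (τ : SigmaType) (h : ℕ → ℕ) : TGD where
  body := [⟨Encodable.encode τ, σ.guard.args⟩]
  head := σ.head.map (fun b => ⟨Encodable.encode (headTypeOf S σ τ h b), b.args⟩)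
  body_ne := by simp
  head_ne := by
    intro hcon
    exact σ.head_ne (List.map_eq_nil_iff.mp hcon)

def IsTypeHom (S : Set TGD) (σ : TGD) (τ : SigmaType) (h : ℕ → ℕ) : Prop :=
  (∀ b ∈ σ.body, b.map h ∈ atomsOfType τ) ∧ σ.guard.map h = τ.1

/-- `lin(Σ)`. -/
def linTGDs (S : Set TGD) : Set TGD :=
  {ρ | ∃ σ ∈ S, ∃ τ : SigmaType, IsSigmaType S τ ∧
    ∃ h : ℕ → ℕ, IsTypeHom S σ τ h ∧ ρ = linTGD S σ τ h}

/-- Equivalence of terms up to linearization. -/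
inductive EqLin (S : Set TGD) : TermT → TermT → Prop
  | const (c : ℕ) : EqLin S (.const c) (.const c)
  | null (σ : TGD) (τ : SigmaType) (g : ℕ → ℕ) (h h' : ℕ → TermT) (z : ℕ)
      (hτ : IsSigmaType S τ) (hg : IsTypeHom S σ τ g)
      (hfr : ∀ y ∈ (linTGD S σ τ g).frontier, EqLin S (h y) (h' y)) :
      EqLin S (.null σ h z) (.null (linTGD S σ τ g) h' z)

/-- The type of an atom of the chase: all chase atoms whose terms occur in it. -/
def typeOf (D : Database) (S : Set TGD) (α : Atom TermT) : Set (Atom TermT) :=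
  {β ∈ chase D S | ∀ t ∈ β.args, t ∈ α.args}

/-- Equivalence of atoms up to linearization. -/
def AtomEqLin (D : Database) (S : Set TGD) (α β : Atom TermT) : Prop :=
  ∃ τ : SigmaType, β.pred = Encodable.encode τ ∧ IsSigmaType S τ ∧
    (∃ μ : TermT → ℕ,
      Set.BijOn μ (adom (typeOf D S α)) {k | ∃ a ∈ atomsOfType τ, k ∈ a.args} ∧
      (Atom.map μ) '' typeOf D S α = ↑(atomsOfType τ) ∧
      α.map μ = τ.1) ∧
    tupleEquiv α.args β.args ∧ List.Forall₂ (EqLin S) α.args β.args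

noncomputable def gsimpleDB (D : Database) (S : Set TGD) : Database := simpleDB (linDB D S)
def gsimpleTGDs (S : Set TGD) : Set TGD := simpleTGDs (linTGDs S)


/-- There is a chase atom having at position `p` a term of depth at least `d`. -/
def HasDepthAt (D : Database) (S : Set TGD) (p : Pos) (d : ℕ) : Prop :=
  ∃ α, InChase D S α ∧ α.sig = p.1 ∧ ∃ t, α.args[p.2]? = some t ∧ d ≤ t.depth

theorem exists_hom (a : Atom ℕ) (hn : a.args.Nodup) (α : Atom TermT) (hs : α.sig = a.sig) :
    ∃ h : ℕ → TermT, a.map h = α := by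
  obtain ⟨p, as⟩ := a
  obtain ⟨q, ts⟩ := α
  simp only [Atom.sig, Prod.mk.injEq] at hs
  obtain ⟨rfl, hl⟩ := hs
  refine ⟨fun x => ts.getD (as.idxOf x) (.const 0), ?_⟩
  simp only [Atom.map, Atom.mk.injEq, true_and]
  apply List.ext_getElem
  · simp [hl]
  · intro i h1 h2
    simp only [List.length_map] at h1
    simp only [List.getElem_map]
    rw [hn.idxOf_getElem i h1]
    simp [h2]

theorem sig_map {T U : Type} (f : T → U) (b : Atom T) : (b.map f).sig = b.sig := by
  simp [Atom.sig, Atom.map]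

theorem step_hom {D : Database} {S : Set TGD} {σ : TGD} (hσ : σ ∈ S) (hsl : σ.SimpleLinear)
    {a : Atom ℕ} (ha : a ∈ σ.body) {α : Atom TermT} (hα : InChase D S α) (hs : α.sig = a.sig) :
    ∃ h : ℕ → TermT, a.map h = α ∧ ∀ b ∈ σ.head, InChase D S (b.map (σ.mu h)) := by
  obtain ⟨a', hb, hn⟩ := hsl
  have : a = a' := by simpa [hb] using ha
  subst this
  obtain ⟨h, hh⟩ := exists_hom a hn α hs
  refine ⟨h, hh, fun b hbh => InChase.step hσ h ?_ ⟨b, hbh, rfl⟩⟩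
  intro b hb'
  have : b = a := by simpa [hb] using hb'
  subst this
  rw [hh]; exact hα

theorem reach_chase {D : Database} {S : Set TGD} (hsl : ∀ σ ∈ S, σ.SimpleLinear)
    {a : Atom ℕ} (ha : a ∈ D) {P : ℕ × ℕ} (hr : Reach S a.sig P) :
    ∃ α, InChase D S α ∧ α.sig = P := by
  induction hr with
  | refl => exact ⟨_, InChase.db ha, sig_map _ _⟩
  | tail _ he ih =>
    obtain ⟨α, hα, hs⟩ := ih
    obtain ⟨σ, hσ, ⟨b, hb, hbs⟩, ⟨e, he, hes⟩⟩ := he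
    obtain ⟨h, _, hh⟩ := step_hom hσ (hsl σ hσ) hb hα (hs.trans hbs.symm)
    exact ⟨_, hh e he, (sig_map _ _).trans hes⟩

theorem edge_aux {D : Database} {S : Set TGD} {p : Pos} {d : ℕ}
    (hp : HasDepthAt D S p d) {σ : TGD} (hσ : σ ∈ S) (hsl : σ.SimpleLinear) {x : ℕ}
    {a : Atom ℕ} (ha : a ∈ σ.body) (hx : occursAt x a p) :
    ∃ h : ℕ → TermT, d ≤ (h x).depth ∧ ∀ b ∈ σ.head, InChase D S (b.map (σ.mu h)) := by
  obtain ⟨α, hα, hs, t, ht, hd⟩ := hp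
  obtain ⟨h, hh, hc⟩ := step_hom hσ hsl ha hα (hs.trans hx.1)
  refine ⟨h, ?_, hc⟩
  subst hh
  simp only [Atom.map, List.getElem?_map, hx.2, Option.map_some, Option.some.injEq] at ht
  rw [ht]; exact hd

theorem hasDepth_head {D : Database} {S : Set TGD} {q : Pos} {d : ℕ} {z : ℕ} {b : Atom ℕ}
    {f : ℕ → TermT} (hc : InChase D S (b.map f)) (hz : occursAt z b q) (hd : d ≤ (f z).depth) :
    HasDepthAt D S q d :=
  ⟨_, hc, (sig_map _ _).trans hz.1.symm, f z, by simp [Atom.map, hz.2], hd⟩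

theorem normal_step {D : Database} {S : Set TGD} (hsl : ∀ σ ∈ S, σ.SimpleLinear) {p q : Pos}
    {d : ℕ} (hp : HasDepthAt D S p d) (he : NormalEdge S p q) : HasDepthAt D S q d := by
  obtain ⟨σ, hσ, x, hx, ⟨a, ha, hxa⟩, ⟨b, hb, hxb⟩⟩ := he
  obtain ⟨h, hd, hc⟩ := edge_aux hp hσ (hsl σ hσ) ha hxa
  exact hasDepth_head (hc b hb) hxb (by simpa [TGD.mu, hx] using hd)

theorem special_step {D : Database} {S : Set TGD} (hsl : ∀ σ ∈ S, σ.SimpleLinear) {p q : Pos}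
    {d : ℕ} (hp : HasDepthAt D S p d) (he : SpecialEdge S p q) : HasDepthAt D S q (d + 1) := by
  obtain ⟨σ, hσ, x, hx, ⟨a, ha, hxa⟩, ⟨z, hz, b, hb, hxb⟩⟩ := he
  obtain ⟨h, hd, hc⟩ := edge_aux hp hσ (hsl σ hσ) ha hxa
  refine hasDepth_head (hc b hb) hxb ?_
  have hzf : z ∉ σ.frontier := fun hf =>
    (Finset.mem_sdiff.mp hz).2 (Finset.mem_inter.mp hf).1
  have h1 : (σ.restrict h x).depth ≤ σ.frontier.sup (fun y => (σ.restrict h y).depth) :=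
    Finset.le_sup (f := fun y => (σ.restrict h y).depth) hx
  have h2 : σ.restrict h x = h x := by simp [TGD.restrict, hx]
  rw [h2] at h1
  simp only [TGD.mu, hzf, if_false, TermT.depth]
  omega

theorem mono_depth {D : Database} {S : Set TGD} {p : Pos} {d e : ℕ} (hde : e ≤ d)
    (hp : HasDepthAt D S p d) : HasDepthAt D S p e := by
  obtain ⟨α, h1, h2, t, h3, h4⟩ := hp
  exact ⟨α, h1, h2, t, h3, hde.trans h4⟩

theorem weakly_acyclic_of_bounded_maxdepth (D : Database) (S : Set TGD) (hfin : S.Finite)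
    (hsl : ∀ σ ∈ S, σ.SimpleLinear)
    (hbd : ∃ k : ℕ, maxdepth D S ≤ (k : ℕ∞)) :
    DWeaklyAcyclic D S := by
  rintro ⟨n, c, sp, hcyc, hedge, ⟨s, hsn, hs⟩, ⟨i, hin, a, haD, hreach⟩⟩
  obtain ⟨k, hk⟩ := hbd
  have hstep0 : ∀ j ≤ n, ∀ d, HasDepthAt D S (c j) d → HasDepthAt D S (c (j + 1)) d := by
    intro j hj d hd
    have he := hedge j hj
    split at he
    · exact mono_depth (Nat.le_succ d) (special_step hsl hd he)
    · exact normal_step hsl hd he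
  have hmod : ∀ j, c ((j + 1) % (n + 1)) = c (j % (n + 1) + 1) := by
    intro j
    have hlt : j % (n + 1) < n + 1 := Nat.mod_lt _ (Nat.succ_pos _)
    rw [Nat.add_mod_eq_ite]
    rcases Nat.lt_or_ge (j % (n + 1)) n with h | h
    · have h1 : 1 % (n + 1) = 1 := Nat.mod_eq_of_lt (by omega)
      rw [h1, if_neg (by omega)]
    · have h2 : j % (n + 1) = n := by omega
      rw [← Nat.add_mod_eq_ite, Nat.add_mod, h2, Nat.add_mod_mod, Nat.mod_self, hcyc]
  have hstep : ∀ j d, HasDepthAt D S (c (j % (n + 1))) d →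
      HasDepthAt D S (c ((j + 1) % (n + 1))) d := by
    intro j d hd
    rw [hmod]
    exact hstep0 _ (Nat.lt_succ_iff.mp (Nat.mod_lt _ (Nat.succ_pos _))) d hd
  have hmany : ∀ j m d, HasDepthAt D S (c (j % (n + 1))) d →
      HasDepthAt D S (c ((j + m) % (n + 1))) d := by
    intro j m d hd
    induction m with
    | zero => exact hd
    | succ m ih => exact hstep (j + m) d ih
  have hall : ∀ d, ∃ j, HasDepthAt D S (c (j % (n + 1))) d := by
    intro d
    induction d with
    | zero =>
      refine ⟨i, ?_⟩
      rw [Nat.mod_eq_of_lt (Nat.lt_succ_of_le hin)]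
      obtain ⟨α, hα, hsig⟩ := reach_chase hsl haD hreach
      have hocc : ∃ (x : ℕ) (b : Atom ℕ), occursAt x b (c i) := by
        have he := hedge i hin
        split at he
        · obtain ⟨σ, _, x, _, ⟨b, _, hb⟩, _⟩ := he
          exact ⟨x, b, hb⟩
        · obtain ⟨σ, _, x, _, ⟨b, _, hb⟩, _⟩ := he
          exact ⟨x, b, hb⟩
      obtain ⟨x, b, hb1, hb2⟩ := hocc
      obtain ⟨hlt, _⟩ := List.getElem?_eq_some_iff.mp hb2
      have hl : α.args.length = b.args.length := congrArg Prod.snd (hsig.trans hb1)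
      rw [← hl] at hlt
      exact ⟨α, hα, hsig, _, List.getElem?_eq_getElem hlt, Nat.zero_le _⟩
    | succ d ih =>
      obtain ⟨j, hj⟩ := ih
      have h1 := hmany j (s + n * j) d hj
      have h2 : (j + (s + n * j)) % (n + 1) = s := by
        have : j + (s + n * j) = s + (n + 1) * j := by ring
        rw [this, Nat.add_mul_mod_self_left, Nat.mod_eq_of_lt (Nat.lt_succ_of_le hsn)]
      refine ⟨j + (s + n * j) + 1, ?_⟩
      rw [hmod, h2]
      rw [h2] at h1
      have he := hedge s hsn
      rw [if_pos hs] at he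
      exact special_step hsl h1 he
  obtain ⟨j, α, hα, _, t, ht, hd⟩ := hall (k + 1)
  unfold maxdepth at hk
  split at hk
  · have hmem : t ∈ adom (chase D S) := ⟨α, hα, List.mem_of_getElem? ht⟩
    have h1 := (le_iSup₂ (f := fun t (_ : t ∈ adom (chase D S)) => (TermT.depth t : ℕ∞)) t hmem).trans hk
    have h2 : t.depth ≤ k := by exact_mod_cast h1
    omega
  · simp at hk
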